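/- arXiv:1701.04841 — 3 statements merged into one kernel-verified Lean document; each statement's English description precedes it below -/
import Mathlib

section
/- Take β = 1, let ρ∞ ∈ P_o(G) be the Gibbs measure, and assume there is λ₀ > 0 with Hess𝓕(σ) ⪰ λ₀·I for all σ ∈ P_o(G). Define the relative entropy H(ρ|ρ∞) = 𝓕(ρ) − 𝓕(ρ∞) and the relative Fisher information I(ρ|ρ∞) = F(ρ)^T L(ρ) F(ρ) = (1/2)Σ_{(i,j)∈E} ω_{ij}·(log(ρ_i·e^{(𝕎ρ)_i+𝕍_i}) − log(ρ_j·e^{(𝕎ρ)_j+𝕍_j}))²·θ_{ij}(ρ). Then there exists a constant λ > 0 such that H(ρ|ρ∞) ≤ (1/(2λ))·I(ρ|ρ∞) for every ρ ∈ P_o(G). -/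
open Finset Filter Matrix
open scoped Classical

noncomputable section

namespace FPEGraph

variable {n : ℕ}

/-- Edge average `θ_{ij}(ρ) = (ρ_i + ρ_j)/2`. -/
def theta (ρ : Fin n → ℝ) (i j : Fin n) : ℝ := (ρ i + ρ j) / 2

/-- Weighted graph Laplacian `L(ρ)`, satisfying
`(L(ρ)Φ)_i = ∑_{j} ω_{ij} θ_{ij}(ρ) (Φ_i - Φ_j)` (the sum over all `j` equals the
sum over neighbors since `ω_{ij} = 0` off edges). -/
def Lmat (ω : Fin n → Fin n → ℝ) (ρ : Fin n → ℝ) : Matrix (Fin n) (Fin n) ℝ :=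
  fun i j => if i = j then ∑ k, ω i k * theta ρ i k else -(ω i j * theta ρ i j)

/-- Graph Laplacian `L̂`, with `(L̂Φ)_i = ∑_{j} ω_{ij} (Φ_i - Φ_j)`. -/
def Lhat (ω : Fin n → Fin n → ℝ) : Matrix (Fin n) (Fin n) ℝ :=
  fun i j => if i = j then ∑ k, ω i k else -(ω i j)

/-- Connectivity of the weighted graph: any two vertices are joined by a chain of edges. -/
def Conn (ω : Fin n → Fin n → ℝ) : Prop :=
  ∀ i j : Fin n, Relation.ReflTransGen (fun a b => ω a b ≠ 0) i j

/-- `ω` encodes a connected undirected weighted graph without self-loops: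
symmetric nonnegative weights, zero diagonal, connected (edges are pairs with `ω_{ij} > 0`,
i.e. `ω_{ij} ≠ 0`). -/
def IsGraph (ω : Fin n → Fin n → ℝ) : Prop :=
  (∀ i j, ω i j = ω j i) ∧ (∀ i, ω i i = 0) ∧ (∀ i j, 0 ≤ ω i j) ∧ Conn ω

/-- The probability simplex `P(G)`. -/
def PG (ρ : Fin n → ℝ) : Prop := (∑ i, ρ i) = 1 ∧ ∀ i, 0 ≤ ρ i

/-- The interior `P_o(G)` of the probability simplex. -/
def PoG (ρ : Fin n → ℝ) : Prop := (∑ i, ρ i) = 1 ∧ ∀ i, 0 < ρ i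

/-- Free energy `𝓕(ρ) = (1/2) ρᵀ𝕎ρ + 𝕍ᵀρ + β ∑ᵢ ρᵢ log ρᵢ`. -/
def freeEnergy (W : Matrix (Fin n) (Fin n) ℝ) (V : Fin n → ℝ) (β : ℝ) (ρ : Fin n → ℝ) : ℝ :=
  (1/2) * (ρ ⬝ᵥ W.mulVec ρ) + V ⬝ᵥ ρ + β * ∑ i, ρ i * Real.log (ρ i)

/-- Gradient `F(ρ)` of the free energy, `F_i(ρ) = 𝕍_i + (𝕎ρ)_i + β log ρ_i + β`. -/
def gradF (W : Matrix (Fin n) (Fin n) ℝ) (V : Fin n → ℝ) (β : ℝ) (ρ : Fin n → ℝ) :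
    Fin n → ℝ :=
  fun i => V i + W.mulVec ρ i + β * Real.log (ρ i) + β

/-- Hessian `Hess𝓕(ρ) = 𝕎 + β diag(1/ρ₁, …, 1/ρₙ)`. -/
def hessF (W : Matrix (Fin n) (Fin n) ℝ) (β : ℝ) (ρ : Fin n → ℝ) :
    Matrix (Fin n) (Fin n) ℝ :=
  W + β • Matrix.diagonal (fun i => (ρ i)⁻¹)

/-- Gibbs measure: `ρ∞ ∈ P_o(G)` with `ρ∞_i = e^{-((𝕎ρ∞)_i + 𝕍_i)/β} / K`. -/
def IsGibbs (W : Matrix (Fin n) (Fin n) ℝ) (V : Fin n → ℝ) (β : ℝ) (ρ : Fin n → ℝ) : Prop :=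
  PoG ρ ∧ ∀ i, ρ i = Real.exp (-(W.mulVec ρ i + V i) / β) /
      ∑ j, Real.exp (-(W.mulVec ρ j + V j) / β)

/-- A continuously differentiable solution `ρ : [0,∞) → P_o(G)` of the Fokker–Planck
equation `ρ' = -L(ρ)F(ρ)`. -/
def IsSolution (ω : Fin n → Fin n → ℝ) (W : Matrix (Fin n) (Fin n) ℝ) (V : Fin n → ℝ)
    (β : ℝ) (ρ : ℝ → Fin n → ℝ) : Prop :=
  (∀ t ∈ Set.Ici (0:ℝ), PoG (ρ t)) ∧
  ∀ t ∈ Set.Ici (0:ℝ),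
    HasDerivWithinAt ρ (-(Lmat ω (ρ t)).mulVec (gradF W V β (ρ t))) (Set.Ici 0) t

/-- `M = e^{2 max_{i,j}(|𝕍_i| + |𝕎_{ij}|)}`. -/
def Mconst (W : Matrix (Fin n) (Fin n) ℝ) (V : Fin n → ℝ) : ℝ :=
  Real.exp (2 * ⨆ i : Fin n, ⨆ j : Fin n, (|V i| + |W i j|))

/-- `m(ρ⁰) = (1/2) (1/(1+(2M)^{1/β}))^{n-2} min{1/(1+(2M)^{1/β}), minᵢ ρ⁰ᵢ}`. -/
def mconst (W : Matrix (Fin n) (Fin n) ℝ) (V : Fin n → ℝ) (β : ℝ) (ρ0 : Fin n → ℝ) : ℝ :=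
  (1/2) * (1 / (1 + (2 * Mconst W V) ^ (1/β)))^(n-2) *
    min (1 / (1 + (2 * Mconst W V) ^ (1/β))) (⨅ i, ρ0 i)

/-- Second smallest eigenvalue (via the Rayleigh quotient on the orthogonal complement of
the constants; for the symmetric PSD Laplacians considered here, whose kernel is spanned by
the constant vector, this is exactly the second-smallest eigenvalue with multiplicity). -/
def lamSec (A : Matrix (Fin n) (Fin n) ℝ) : ℝ :=
  sInf {x | ∃ Φ : Fin n → ℝ, (∑ i, Φ i) = 0 ∧ (∑ i, (Φ i)^2) = 1 ∧ x = Φ ⬝ᵥ A.mulVec Φ}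

/-- Largest eigenvalue of a symmetric matrix, via the Rayleigh quotient. -/
def lamMax (A : Matrix (Fin n) (Fin n) ℝ) : ℝ :=
  sSup {x | ∃ Φ : Fin n → ℝ, (∑ i, (Φ i)^2) = 1 ∧ x = Φ ⬝ᵥ A.mulVec Φ}

/-- Maximum absolute column sum norm `‖A‖₁`. -/
def matNorm1 (A : Matrix (Fin n) (Fin n) ℝ) : ℝ := ⨆ j : Fin n, ∑ i, |A i j|

/-- Maximal vertex degree `Deg(G)`. -/
def maxDeg (ω : Fin n → Fin n → ℝ) : ℕ :=
  Finset.univ.sup fun i => (Finset.univ.filter fun j => ω i j ≠ 0).card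

/-- Maximal edge weight `max_{(i,j)∈E} ω_{ij}` (equal to the max over all pairs since
`ω = 0` off edges and weights are positive on edges). -/
def maxWeight (ω : Fin n → Fin n → ℝ) : ℝ := ⨆ i : Fin n, ⨆ j : Fin n, ω i j

/-- A vector field on `G`: a skew-symmetric matrix vanishing off edges. -/
def IsVF (ω : Fin n → Fin n → ℝ) (v : Fin n → Fin n → ℝ) : Prop :=
  (∀ i j, v i j = - v j i) ∧ ∀ i j, ω i j = 0 → v i j = 0

/-- Potential vector field `(∇_G Φ)_{ij} = √ω_{ij} (Φ_i - Φ_j)` (this vanishes off edges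
since `ω_{ij} = 0` there). -/
def gradG (ω : Fin n → Fin n → ℝ) (Φ : Fin n → ℝ) : Fin n → Fin n → ℝ :=
  fun i j => Real.sqrt (ω i j) * (Φ i - Φ j)

/-- Divergence `div_G(ρv)_i = -∑_j √ω_{ij} v_{ij} θ_{ij}(ρ)` (sum over all `j` equals the
sum over neighbors since `√ω_{ij} = 0` off edges). -/
def divG (ω : Fin n → Fin n → ℝ) (ρ : Fin n → ℝ) (v : Fin n → Fin n → ℝ) : Fin n → ℝ :=
  fun i => -∑ j, Real.sqrt (ω i j) * v i j * theta ρ i j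

/-- Inner product `(v,w)_ρ = (1/2) ∑_{(i,j)∈E} v_{ij} w_{ij} θ_{ij}(ρ)`. -/
def innerG (ω : Fin n → Fin n → ℝ) (ρ : Fin n → ℝ) (v w : Fin n → Fin n → ℝ) : ℝ :=
  (1/2) * ∑ i, ∑ j, if ω i j ≠ 0 then v i j * w i j * theta ρ i j else 0


/-- The Dirichlet form of a potential `Φ`; at `Φ = F(ρ)` it is the relative Fisher
information. -/
def dirichlet (ω : Fin n → Fin n → ℝ) (ρ Φ : Fin n → ℝ) : ℝ :=
  (1/2) * ∑ i, ∑ j, ω i j * (Φ i - Φ j)^2 * theta ρ i j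

lemma dotProduct_Lmat_mulVec (ω : Fin n → Fin n → ℝ) (hsymm : ∀ i j, ω i j = ω j i)
    (hdiag : ∀ i, ω i i = 0) (ρ Φ : Fin n → ℝ) :
    Φ ⬝ᵥ (Lmat ω ρ).mulVec Φ = dirichlet ω ρ Φ := by
  have hrow : ∀ i, (Lmat ω ρ).mulVec Φ i = ∑ j, ω i j * theta ρ i j * (Φ i - Φ j) := by
    intro i
    have hentry : ∀ j, Lmat ω ρ i j * Φ j =
        (if i = j then (∑ k, ω i k * theta ρ i k) * Φ i else 0) - ω i j * theta ρ i j * Φ j := by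
      intro j
      unfold Lmat
      split_ifs with h
      · subst h; simp [hdiag]
      · ring
    simp only [Matrix.mulVec, dotProduct, hentry, Finset.sum_sub_distrib, Finset.sum_ite_eq,
      Finset.mem_univ, if_true, mul_sub, Finset.sum_mul]
  have hswap : ∑ i, ∑ j, ω i j * theta ρ i j * (Φ i - Φ j) * Φ i =
      ∑ i, ∑ j, -(ω i j * theta ρ i j * (Φ i - Φ j) * Φ j) := by
    rw [Finset.sum_comm]
    refine Finset.sum_congr rfl fun i _ => Finset.sum_congr rfl fun j _ => ?_
    rw [hsymm j i]; unfold theta; ring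
  have hsplit : ∑ i, ∑ j, ω i j * (Φ i - Φ j)^2 * theta ρ i j =
      ∑ i, ∑ j, ω i j * theta ρ i j * (Φ i - Φ j) * Φ i +
      ∑ i, ∑ j, -(ω i j * theta ρ i j * (Φ i - Φ j) * Φ j) := by
    simp only [← Finset.sum_add_distrib]
    refine Finset.sum_congr rfl fun i _ => Finset.sum_congr rfl fun j _ => ?_
    ring
  have hlhs : Φ ⬝ᵥ (Lmat ω ρ).mulVec Φ =
      ∑ i, ∑ j, ω i j * theta ρ i j * (Φ i - Φ j) * Φ i := by
    simp only [dotProduct, hrow, Finset.mul_sum]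
    refine Finset.sum_congr rfl fun i _ => Finset.sum_congr rfl fun j _ => ?_
    ring
  rw [dirichlet, hsplit, ← hswap, hlhs]; ring

lemma edge_le_dirichlet {ω : Fin n → Fin n → ℝ} (hω : ∀ i j, 0 ≤ ω i j) {ρ : Fin n → ℝ}
    (hρ : ∀ i, 0 < ρ i) (Φ : Fin n → ℝ) (i j : Fin n) :
    ω i j * (Φ i - Φ j)^2 * ρ i ≤ 4 * dirichlet ω ρ Φ := by
  have hθ : ∀ k l, 0 ≤ theta ρ k l := fun k l => by
    unfold theta; linarith [hρ k, hρ l]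
  have hnn : ∀ k l, 0 ≤ ω k l * (Φ k - Φ l)^2 * theta ρ k l := fun k l =>
    mul_nonneg (mul_nonneg (hω k l) (sq_nonneg _)) (hθ k l)
  have hinner : ω i j * (Φ i - Φ j)^2 * theta ρ i j ≤
      ∑ l, ω i l * (Φ i - Φ l)^2 * theta ρ i l :=
    Finset.single_le_sum (f := fun l => ω i l * (Φ i - Φ l)^2 * theta ρ i l)
      (fun l _ => hnn i l) (Finset.mem_univ j)
  have houter : ∑ l, ω i l * (Φ i - Φ l)^2 * theta ρ i l ≤
      ∑ k, ∑ l, ω k l * (Φ k - Φ l)^2 * theta ρ k l :=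
    Finset.single_le_sum (f := fun k => ∑ l, ω k l * (Φ k - Φ l)^2 * theta ρ k l)
      (fun k _ => Finset.sum_nonneg fun l _ => hnn k l) (Finset.mem_univ i)
  have hhalf : ω i j * (Φ i - Φ j)^2 * (ρ i / 2) ≤ ω i j * (Φ i - Φ j)^2 * theta ρ i j := by
    refine mul_le_mul_of_nonneg_left ?_ (mul_nonneg (hω i j) (sq_nonneg _))
    unfold theta; linarith [hρ j]
  unfold dirichlet
  linarith

lemma PoG.le_one {ρ : Fin n → ℝ} (hρ : PoG ρ) (i : Fin n) : ρ i ≤ 1 := by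
  rw [← hρ.1]
  exact Finset.single_le_sum (fun j _ => (hρ.2 j).le) (Finset.mem_univ i)

/-- A bound for the linear and quadratic data of the free energy. -/
def dataBound (W : Matrix (Fin n) (Fin n) ℝ) (V : Fin n → ℝ) : ℝ :=
  ∑ i, (|V i| + ∑ j, |W i j|)

lemma abs_mulVec_le (W : Matrix (Fin n) (Fin n) ℝ) {ρ : Fin n → ℝ} (hρ : PoG ρ) (i : Fin n) :
    |W.mulVec ρ i| ≤ ∑ j, |W i j| := by
  simp only [Matrix.mulVec, dotProduct]
  refine (Finset.abs_sum_le_sum_abs _ _).trans (Finset.sum_le_sum fun j _ => ?_)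
  rw [abs_mul, abs_of_pos (hρ.2 j)]
  exact mul_le_of_le_one_right (abs_nonneg _) (hρ.le_one j)

lemma abs_potential_le (W : Matrix (Fin n) (Fin n) ℝ) (V : Fin n → ℝ) {ρ : Fin n → ℝ}
    (hρ : PoG ρ) (i : Fin n) : |V i + W.mulVec ρ i| ≤ dataBound W V := by
  refine (abs_add_le _ _).trans ((add_le_add le_rfl (abs_mulVec_le W hρ i)).trans ?_)
  exact Finset.single_le_sum (f := fun i => |V i| + ∑ j, |W i j|)
    (fun k _ => add_nonneg (abs_nonneg _) (Finset.sum_nonneg fun _ _ => abs_nonneg _))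
    (Finset.mem_univ i)

lemma freeEnergy_le_dataBound (W : Matrix (Fin n) (Fin n) ℝ) (V : Fin n → ℝ) {ρ : Fin n → ℝ}
    (hρ : PoG ρ) : freeEnergy W V 1 ρ ≤ dataBound W V := by
  unfold freeEnergy dataBound dotProduct
  rw [Finset.mul_sum, Finset.mul_sum, ← Finset.sum_add_distrib, ← Finset.sum_add_distrib]
  refine Finset.sum_le_sum fun i _ => ?_
  have hpos := hρ.2 i
  have hle := hρ.le_one i
  have hV : V i * ρ i ≤ |V i| := by
    nlinarith [le_abs_self (V i), abs_nonneg (V i)]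
  have hW : ρ i * W.mulVec ρ i ≤ |W.mulVec ρ i| := by
    nlinarith [le_abs_self (W.mulVec ρ i), abs_nonneg (W.mulVec ρ i)]
  have hlog : ρ i * Real.log (ρ i) ≤ 0 :=
    mul_nonpos_of_nonneg_of_nonpos hpos.le (Real.log_nonpos hpos.le hle)
  have hrow := abs_mulVec_le W hρ i
  linarith [(abs_nonneg (W.mulVec ρ i)).trans hrow]

/-- If the Fisher information is at most `1`, mass at `i` propagates to every vertex connected
to `i`, and the oscillation of the gradient is controlled. -/
lemma exists_oscillation_bound {ω : Fin n → Fin n → ℝ} (hω : ∀ i j, 0 ≤ ω i j)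
    (W : Matrix (Fin n) (Fin n) ℝ) (V : Fin n → ℝ) {a : ℝ} (ha : 0 < a) {i j : Fin n}
    (hij : Relation.ReflTransGen (fun a b => ω a b ≠ 0) i j) :
    ∃ b > 0, ∃ C ≥ 0, ∀ ρ : Fin n → ℝ, PoG ρ → dirichlet ω ρ (gradF W V 1 ρ) ≤ 1 → a ≤ ρ i →
      b ≤ ρ j ∧
        (gradF W V 1 ρ j - gradF W V 1 ρ i)^2 ≤ C * dirichlet ω ρ (gradF W V 1 ρ) := by
  induction hij with
  | refl => exact ⟨a, ha, 0, le_rfl, fun ρ _ _ h => ⟨h, by simp⟩⟩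
  | @tail j k _ hjk ih =>
    obtain ⟨b, hb, C, hC, H⟩ := ih
    have hwpos : 0 < ω j k := lt_of_le_of_ne (hω j k) (Ne.symm hjk)
    refine ⟨Real.exp (Real.log b - 2 * dataBound W V - (1 + 4 / (ω j k * b))), Real.exp_pos _,
      2 * C + 2 * (4 / (ω j k * b)), by positivity, fun ρ hρ hI hi => ?_⟩
    obtain ⟨hj, hosc⟩ := H ρ hρ hI hi
    have hedge := edge_le_dirichlet hω hρ.2 (gradF W V 1 ρ) j k
    set Φ := gradF W V 1 ρ with hΦ
    set D := dirichlet ω ρ Φ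
    have hstep : (Φ j - Φ k)^2 ≤ 4 / (ω j k * b) * D := by
      rw [div_mul_eq_mul_div, le_div_iff₀ (by positivity)]
      have : (Φ j - Φ k)^2 * (ω j k * b) ≤ (Φ j - Φ k)^2 * (ω j k * ρ j) := by gcongr
      linarith
    constructor
    · have hstep' : (Φ j - Φ k)^2 ≤ 4 / (ω j k * b) :=
        hstep.trans (mul_le_of_le_one_right (by positivity) hI)
      have hlogb : Real.log b ≤ Real.log (ρ j) := Real.log_le_log hb hj
      have hdj := abs_le.1 (abs_potential_le W V hρ j)
      have hdk := abs_le.1 (abs_potential_le W V hρ k)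
      have hdiff : Φ j - Φ k = (V j + W.mulVec ρ j) + Real.log (ρ j) -
          (V k + W.mulVec ρ k) - Real.log (ρ k) := by
        simp only [hΦ, gradF]; ring
      rw [← Real.le_log_iff_exp_le (hρ.2 k)]
      have : Φ j - Φ k ≤ 1 + (Φ j - Φ k)^2 := by nlinarith [sq_nonneg (Φ j - Φ k - 1)]
      linarith
    · nlinarith [sq_nonneg ((Φ j - Φ i) + (Φ j - Φ k))]

lemma segment_hasDerivAt (ρ d : Fin n → ℝ) (t : ℝ) (i : Fin n) :
    HasDerivAt (fun s : ℝ => (ρ + s • d) i) (d i) t := by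
  simpa using ((hasDerivAt_id t).mul_const (d i)).const_add (ρ i)

lemma mulVec_segment_hasDerivAt (W : Matrix (Fin n) (Fin n) ℝ) (ρ d : Fin n → ℝ) (t : ℝ)
    (i : Fin n) : HasDerivAt (fun s : ℝ => W.mulVec (ρ + s • d) i) (W.mulVec d i) t := by
  simp only [Matrix.mulVec, dotProduct]
  exact HasDerivAt.fun_sum fun j _ => (segment_hasDerivAt ρ d t j).const_mul (W i j)

lemma freeEnergy_hasDerivAt (W : Matrix (Fin n) (Fin n) ℝ) (hW : W.IsSymm) (V : Fin n → ℝ)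
    (ρ d : Fin n → ℝ) (t : ℝ) (ht : ∀ i, 0 < (ρ + t • d) i) :
    HasDerivAt (fun s : ℝ => freeEnergy W V 1 (ρ + s • d))
      (gradF W V 1 (ρ + t • d) ⬝ᵥ d) t := by
  have hcoord := segment_hasDerivAt ρ d t
  have hmv := mulVec_segment_hasDerivAt W ρ d t
  have hquad : HasDerivAt (fun s : ℝ => (ρ + s • d) ⬝ᵥ W.mulVec (ρ + s • d))
      (∑ i, (d i * W.mulVec (ρ + t • d) i + (ρ + t • d) i * W.mulVec d i)) t :=
    HasDerivAt.fun_sum fun i _ => (hcoord i).mul (hmv i)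
  have hlin : HasDerivAt (fun s : ℝ => V ⬝ᵥ (ρ + s • d)) (∑ i, V i * d i) t :=
    HasDerivAt.fun_sum fun i _ => (hcoord i).const_mul (V i)
  have hent : HasDerivAt (fun s : ℝ => ∑ i, (ρ + s • d) i * Real.log ((ρ + s • d) i))
      (∑ i, (Real.log ((ρ + t • d) i) + 1) * d i) t :=
    HasDerivAt.fun_sum fun i _ =>
      HasDerivAt.comp (h₂ := fun x => x * Real.log x) t (Real.hasDerivAt_mul_log (ht i).ne')
        (hcoord i)
  have hsymm : ∑ i, (ρ + t • d) i * W.mulVec d i = ∑ i, d i * W.mulVec (ρ + t • d) i := by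
    change (ρ + t • d) ⬝ᵥ W.mulVec d = d ⬝ᵥ W.mulVec (ρ + t • d)
    rw [Matrix.dotProduct_mulVec, ← Matrix.mulVec_transpose, hW.eq, dotProduct_comm]
  refine (((hquad.const_mul (1/2)).add hlin).add (hent.const_mul 1)).congr_deriv ?_
  rw [Finset.sum_add_distrib, hsymm]
  simp only [gradF, dotProduct, one_mul]
  rw [← two_mul, ← mul_assoc, show (1/2 : ℝ) * 2 = 1 by norm_num, one_mul]
  simp only [← Finset.sum_add_distrib]
  refine Finset.sum_congr rfl fun i _ => ?_
  ring

lemma gradF_hasDerivAt (W : Matrix (Fin n) (Fin n) ℝ) (V : Fin n → ℝ)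
    (ρ d : Fin n → ℝ) (t : ℝ) (ht : ∀ i, 0 < (ρ + t • d) i) :
    HasDerivAt (fun s : ℝ => gradF W V 1 (ρ + s • d) ⬝ᵥ d)
      (d ⬝ᵥ (hessF W 1 (ρ + t • d)).mulVec d) t := by
  have hcoord := segment_hasDerivAt ρ d t
  have hmv := mulVec_segment_hasDerivAt W ρ d t
  have hgrad : HasDerivAt (fun s : ℝ => gradF W V 1 (ρ + s • d) ⬝ᵥ d)
      (∑ i, (W.mulVec d i + 1 * (d i / (ρ + t • d) i)) * d i) t :=
    HasDerivAt.fun_sum fun i _ =>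
      ((((hmv i).const_add (V i)).add (((hcoord i).log (ht i).ne').const_mul 1)).add_const
        1).mul_const (d i)
  refine hgrad.congr_deriv ?_
  simp only [hessF, Matrix.add_mulVec, one_smul, dotProduct, Pi.add_apply,
    Matrix.mulVec_diagonal]
  refine Finset.sum_congr rfl fun i _ => ?_
  rw [div_eq_mul_inv]; ring

lemma PoG.segment {ρ σ : Fin n → ℝ} (hρ : PoG ρ) (hσ : PoG σ) {t : ℝ} (ht : t ∈ Set.Icc (0:ℝ) 1) :
    PoG (ρ + t • (σ - ρ)) := by
  constructor
  · simp [Finset.sum_add_distrib, ← Finset.mul_sum, hρ.1, hσ.1]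
  · intro i
    simp only [Pi.add_apply, Pi.smul_apply, Pi.sub_apply, smul_eq_mul]
    rcases ht.2.eq_or_lt with rfl | h1
    · simpa using hσ.2 i
    · nlinarith [mul_nonneg ht.1 (hσ.2 i).le, mul_pos (sub_pos.2 h1) (hρ.2 i)]

/-- Strong convexity of the free energy, in first-order form. -/
lemma freeEnergy_strongConvex (W : Matrix (Fin n) (Fin n) ℝ) (hW : W.IsSymm) (V : Fin n → ℝ)
    {lam0 : ℝ}
    (hHess : ∀ σ : Fin n → ℝ, PoG σ → ∀ Φ : Fin n → ℝ,
      lam0 * (∑ i, (Φ i)^2) ≤ Φ ⬝ᵥ (hessF W 1 σ).mulVec Φ)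
    {ρ σ : Fin n → ℝ} (hρ : PoG ρ) (hσ : PoG σ) :
    freeEnergy W V 1 ρ + gradF W V 1 ρ ⬝ᵥ (σ - ρ) + lam0 / 2 * ∑ i, (σ i - ρ i)^2 ≤
      freeEnergy W V 1 σ := by
  set d := σ - ρ with hd
  set q := ∑ i, (σ i - ρ i)^2 with hq
  have hpos : ∀ t ∈ Set.Icc (0:ℝ) 1, ∀ i, 0 < (ρ + t • d) i := fun t ht =>
    (hρ.segment hσ ht).2
  let h : ℝ → ℝ := fun t => freeEnergy W V 1 (ρ + t • d) - lam0 / 2 * q * t^2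
  let h' : ℝ → ℝ := fun t => gradF W V 1 (ρ + t • d) ⬝ᵥ d - lam0 * q * t
  have hder : ∀ t ∈ Set.Icc (0:ℝ) 1, HasDerivAt h (h' t) t := fun t ht => by
    refine ((freeEnergy_hasDerivAt W hW V ρ d t (hpos t ht)).sub
      ((hasDerivAt_pow 2 t).const_mul (lam0 / 2 * q))).congr_deriv ?_
    simp only [h']; push_cast; ring
  have hder2 : ∀ t ∈ Set.Icc (0:ℝ) 1, HasDerivAt h'
      (d ⬝ᵥ (hessF W 1 (ρ + t • d)).mulVec d - lam0 * q) t := fun t ht => by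
    refine ((gradF_hasDerivAt W V ρ d t (hpos t ht)).sub
      ((hasDerivAt_id t).const_mul (lam0 * q))).congr_deriv ?_
    rw [mul_one]
  have hconv : ConvexOn ℝ (Set.Icc (0:ℝ) 1) h := by
    refine convexOn_of_hasDerivWithinAt2_nonneg (f' := h')
      (f'' := fun t => d ⬝ᵥ (hessF W 1 (ρ + t • d)).mulVec d - lam0 * q) (convex_Icc 0 1)
      (fun t ht => (hder t ht).continuousAt.continuousWithinAt)
      (fun t ht => (hder t (interior_subset ht)).hasDerivWithinAt)
      (fun t ht => (hder2 t (interior_subset ht)).hasDerivWithinAt)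
      (fun t ht => sub_nonneg.2 ?_)
    exact hHess _ (hρ.segment hσ (interior_subset ht)) d
  have hslope := hconv.le_slope_of_hasDerivAt (Set.left_mem_Icc.2 zero_le_one)
    (Set.right_mem_Icc.2 zero_le_one) zero_lt_one (hder 0 (Set.left_mem_Icc.2 zero_le_one))
  have hone : ρ + (1:ℝ) • d = σ := by simp [hd]
  simp only [slope_def_field, h, h', hone, zero_smul, add_zero] at hslope
  linarith

/-- Relative entropy is bounded by the squared oscillation of the gradient around any
constant `c`. -/
lemma relEntropy_le_oscillation (W : Matrix (Fin n) (Fin n) ℝ) (hW : W.IsSymm) (V : Fin n → ℝ)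
    {lam0 : ℝ} (hlam0 : 0 < lam0)
    (hHess : ∀ σ : Fin n → ℝ, PoG σ → ∀ Φ : Fin n → ℝ,
      lam0 * (∑ i, (Φ i)^2) ≤ Φ ⬝ᵥ (hessF W 1 σ).mulVec Φ)
    {ρ σ : Fin n → ℝ} (hρ : PoG ρ) (hσ : PoG σ) (c : ℝ) :
    freeEnergy W V 1 ρ - freeEnergy W V 1 σ ≤
      1 / (2 * lam0) * ∑ i, (gradF W V 1 ρ i - c)^2 := by
  have hsc := freeEnergy_strongConvex W hW V hHess hρ hσ
  have hshift : gradF W V 1 ρ ⬝ᵥ (σ - ρ) = ∑ i, (gradF W V 1 ρ i - c) * (σ i - ρ i) := by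
    simp only [sub_mul, Finset.sum_sub_distrib, ← Finset.mul_sum, hρ.1, hσ.1, dotProduct,
      Pi.sub_apply]
    ring
  have hyoung : -∑ i, (gradF W V 1 ρ i - c) * (σ i - ρ i) ≤
      1 / (2 * lam0) * ∑ i, (gradF W V 1 ρ i - c)^2 + lam0 / 2 * ∑ i, (σ i - ρ i)^2 := by
    rw [← Finset.sum_neg_distrib, Finset.mul_sum, Finset.mul_sum, ← Finset.sum_add_distrib]
    refine Finset.sum_le_sum fun i _ => ?_
    have hsquare : 0 ≤ 1 / (2 * lam0) *
        ((gradF W V 1 ρ i - c) + lam0 * (σ i - ρ i))^2 := by positivity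
    have hexpand : 1 / (2 * lam0) * ((gradF W V 1 ρ i - c) + lam0 * (σ i - ρ i))^2 =
        1 / (2 * lam0) * (gradF W V 1 ρ i - c)^2 + lam0 / 2 * (σ i - ρ i)^2 +
          (gradF W V 1 ρ i - c) * (σ i - ρ i) := by
      field_simp; ring
    linarith
  linarith

lemma PoG.exists_inv_le {ρ : Fin n → ℝ} (hρ : PoG ρ) (hn : 0 < n) : ∃ i, (n:ℝ)⁻¹ ≤ ρ i := by
  have : Nonempty (Fin n) := ⟨⟨0, hn⟩⟩
  have hsum : ∑ _i : Fin n, (n:ℝ)⁻¹ ≤ ∑ i, ρ i := by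
    rw [hρ.1]; simp [hn.ne']
  obtain ⟨i, -, hi⟩ := Finset.exists_le_of_sum_le Finset.univ_nonempty hsum
  exact ⟨i, hi⟩

/-- log-Sobolev type inequality on graphs, `β = 1`: there is `λ > 0` with
`H(ρ|ρ∞) ≤ (1/(2λ)) I(ρ|ρ∞)` for all `ρ ∈ P_o(G)`, where `H(ρ|ρ∞) = 𝓕(ρ) - 𝓕(ρ∞)` and
`I(ρ|ρ∞) = F(ρ)ᵀL(ρ)F(ρ)
  = (1/2)∑_{(i,j)∈E} ω_{ij} (log(ρ_i e^{(𝕎ρ)_i+𝕍_i}) - log(ρ_j e^{(𝕎ρ)_j+𝕍_j}))² θ_{ij}(ρ)`. -/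
theorem log_sobolev
    (n : ℕ) (hn : 2 ≤ n) (ω : Fin n → Fin n → ℝ) (hG : IsGraph ω)
    (W : Matrix (Fin n) (Fin n) ℝ) (hW : W.IsSymm) (V : Fin n → ℝ)
    (ρinf : Fin n → ℝ) (hGibbs : IsGibbs W V 1 ρinf)
    (lam0 : ℝ) (hlam0 : 0 < lam0)
    (hHess : ∀ σ : Fin n → ℝ, PoG σ → ∀ Φ : Fin n → ℝ,
      lam0 * (∑ i, (Φ i)^2) ≤ Φ ⬝ᵥ (hessF W 1 σ).mulVec Φ) :
    ∃ lam : ℝ, 0 < lam ∧ ∀ ρ : Fin n → ℝ, PoG ρ →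
      (gradF W V 1 ρ ⬝ᵥ (Lmat ω ρ).mulVec (gradF W V 1 ρ) =
        (1/2) * ∑ i, ∑ j, ω i j *
          (Real.log (ρ i * Real.exp (W.mulVec ρ i + V i)) -
            Real.log (ρ j * Real.exp (W.mulVec ρ j + V j)))^2 * theta ρ i j) ∧
      freeEnergy W V 1 ρ - freeEnergy W V 1 ρinf ≤
        (1 / (2 * lam)) * (gradF W V 1 ρ ⬝ᵥ (Lmat ω ρ).mulVec (gradF W V 1 ρ)) := by
  have hsymm := hG.1
  have hdiag := hG.2.1
  have hω := hG.2.2.1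
  have hn0 : 0 < n := by omega
  choose b _ C hC hosc using fun i j =>
    exists_oscillation_bound hω W V (inv_pos.2 (Nat.cast_pos.2 hn0)) (hG.2.2.2 i j)
  set K := |dataBound W V - freeEnergy W V 1 ρinf| with hK
  set B := 1 / (2 * lam0) * ∑ i, ∑ j, C i j with hB
  have hB0 : 0 ≤ B :=
    mul_nonneg (by positivity) (Finset.sum_nonneg fun i _ => Finset.sum_nonneg fun j _ => hC i j)
  have hK0 : 0 ≤ K := abs_nonneg _
  refine ⟨1 / (2 * (K + B + 1)), by positivity, fun ρ hρ => ?_⟩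
  rw [dotProduct_Lmat_mulVec ω hsymm hdiag]
  refine ⟨?_, ?_⟩
  · have hlog : ∀ i, Real.log (ρ i * Real.exp (W.mulVec ρ i + V i)) = gradF W V 1 ρ i - 1 := by
      intro i
      rw [Real.log_mul (hρ.2 i).ne' (Real.exp_ne_zero _), Real.log_exp]
      unfold gradF; ring
    simp only [hlog, dirichlet, sub_sub_sub_cancel_right]
  · have hconst : 1 / (2 * (1 / (2 * (K + B + 1)))) = K + B + 1 := by field_simp
    rw [hconst]
    rcases le_total (dirichlet ω ρ (gradF W V 1 ρ)) 1 with hI | hI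
    · obtain ⟨i, hi⟩ := hρ.exists_inv_le hn0
      have hent := relEntropy_le_oscillation W hW V hlam0 hHess hρ hGibbs.1 (gradF W V 1 ρ i)
      set D := dirichlet ω ρ (gradF W V 1 ρ) with hD
      have hD0 : 0 ≤ D := by
        have := edge_le_dirichlet hω hρ.2 (gradF W V 1 ρ) i i
        rw [hdiag] at this
        linarith
      have hsum : ∑ j, (gradF W V 1 ρ j - gradF W V 1 ρ i)^2 ≤ (∑ k, ∑ j, C k j) * D :=
        calc ∑ j, (gradF W V 1 ρ j - gradF W V 1 ρ i)^2 ≤ ∑ j, C i j * D :=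
              Finset.sum_le_sum fun j _ => (hosc i j ρ hρ hI hi).2
          _ = (∑ j, C i j) * D := by rw [Finset.sum_mul]
          _ ≤ (∑ k, ∑ j, C k j) * D := mul_le_mul_of_nonneg_right
              (Finset.single_le_sum (f := fun k => ∑ j, C k j)
                (fun k _ => Finset.sum_nonneg fun j _ => hC k j) (Finset.mem_univ i)) hD0
      have hBD : 1 / (2 * lam0) * ∑ j, (gradF W V 1 ρ j - gradF W V 1 ρ i)^2 ≤ B * D := by
        rw [hB, mul_assoc]
        exact mul_le_mul_of_nonneg_left hsum (by positivity)
      nlinarith [mul_nonneg hK0 hD0]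
    · have hbound := freeEnergy_le_dataBound W V hρ
      have hKabs := le_abs_self (dataBound W V - freeEnergy W V 1 ρinf)
      nlinarith [mul_le_mul_of_nonneg_left hI (by positivity : 0 ≤ K + B + 1)]

end FPEGraph
end
end

section
/- Let ρ : [0,∞) → P_o(G) be a continuously differentiable solution of the Fokker–Planck equation ρ'(t) = −L(ρ(t))F(ρ(t)) with ρ(0) = ρ⁰ ∈ P_o(G), and assume lim_{t→∞} ρ(t) = ρ∞ where ρ∞ ∈ P_o(G) is an isolated equilibrium (isolated zero of the vector field −L(·)F(·) in P_o(G)). Define λ = min{ Φ^T L(ρ∞) Hess𝓕(ρ∞) L(ρ∞) Φ : Φ ∈ ℝ^n, Φ^T L(ρ∞) Φ = 1 } and assume λ > 0. Then for every ε ∈ (0, λ) there exists T > 0 such that for all t > T, 𝓕(ρ(t)) − 𝓕(ρ∞) ≤ e^{−2(λ−ε)(t−T)}·(𝓕(ρ⁰) − 𝓕(ρ∞)). -/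
open Finset Filter Matrix
open scoped Classical

noncomputable section

namespace FPEGraph

variable {n : ℕ}

section Laplacian

variable {ω : Fin n → Fin n → ℝ}

lemma Lmat_mulVec (h0 : ∀ i, ω i i = 0) (ρ Φ : Fin n → ℝ) (i : Fin n) :
    (Lmat ω ρ *ᵥ Φ) i = ∑ j, ω i j * theta ρ i j * (Φ i - Φ j) := by
  have h : ∀ j, Lmat ω ρ i j * Φ j =
      (if i = j then (∑ k, ω i k * theta ρ i k) * Φ i else 0) - ω i j * theta ρ i j * Φ j := by
    intro j
    by_cases hij : i = j
    · subst hij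
      simp [Lmat, h0]
    · simp [Lmat, hij]
  simp only [mulVec, dotProduct, h, Finset.sum_sub_distrib, mul_sub, Finset.sum_mul]
  simp

lemma Lmat_isSymm (hs : ∀ i j, ω i j = ω j i) (ρ : Fin n → ℝ) : (Lmat ω ρ).IsSymm := by
  refine Matrix.IsSymm.ext fun i j => ?_
  by_cases hij : i = j
  · subst hij
    rfl
  · simp [Lmat, hij, Ne.symm hij, theta, hs i j, add_comm]

lemma Lmat_zero : Lmat ω 0 = 0 := by
  ext i j
  simp [Lmat, theta]

lemma Lmat_mulVec_const (h0 : ∀ i, ω i i = 0) (ρ : Fin n → ℝ) (c : ℝ) :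
    Lmat ω ρ *ᵥ (fun _ => c) = 0 := by
  ext i
  simp [Lmat_mulVec h0]

lemma dotProduct_Lmat_mulVec_s9 (hs : ∀ i j, ω i j = ω j i) (h0 : ∀ i, ω i i = 0)
    (ρ Φ : Fin n → ℝ) :
    Φ ⬝ᵥ Lmat ω ρ *ᵥ Φ = (∑ i, ∑ j, ω i j * theta ρ i j * (Φ i - Φ j) ^ 2) / 2 := by
  have h1 : Φ ⬝ᵥ Lmat ω ρ *ᵥ Φ = ∑ i, ∑ j, ω i j * theta ρ i j * (Φ i - Φ j) * Φ i := by
    simp only [dotProduct, Lmat_mulVec h0, Finset.mul_sum]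
    exact Finset.sum_congr rfl fun i _ => Finset.sum_congr rfl fun j _ => by ring
  have h2 : Φ ⬝ᵥ Lmat ω ρ *ᵥ Φ = ∑ i, ∑ j, -(ω i j * theta ρ i j * (Φ i - Φ j) * Φ j) := by
    rw [h1, Finset.sum_comm]
    refine Finset.sum_congr rfl fun i _ => Finset.sum_congr rfl fun j _ => ?_
    rw [hs j i, theta, theta]
    ring
  have h3 : ∑ i, ∑ j, ω i j * theta ρ i j * (Φ i - Φ j) ^ 2 =
      (Φ ⬝ᵥ Lmat ω ρ *ᵥ Φ) + Φ ⬝ᵥ Lmat ω ρ *ᵥ Φ := by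
    nth_rewrite 1 [h1]
    rw [h2, ← Finset.sum_add_distrib]
    refine Finset.sum_congr rfl fun i _ => ?_
    rw [← Finset.sum_add_distrib]
    exact Finset.sum_congr rfl fun j _ => by ring
  rw [h3]
  ring

lemma theta_pos {ρ : Fin n → ℝ} (hρ : ∀ i, 0 < ρ i) (i j : Fin n) : 0 < theta ρ i j := by
  have := hρ i
  have := hρ j
  unfold theta
  linarith

lemma edgeTerm_nonneg (hω : ∀ i j, 0 ≤ ω i j) {ρ : Fin n → ℝ} (hρ : ∀ i, 0 < ρ i)
    (Φ : Fin n → ℝ) (i j : Fin n) : 0 ≤ ω i j * theta ρ i j * (Φ i - Φ j) ^ 2 :=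
  mul_nonneg (mul_nonneg (hω i j) (theta_pos hρ i j).le) (sq_nonneg _)

lemma dotProduct_Lmat_mulVec_nonneg (hG : IsGraph ω) {ρ : Fin n → ℝ} (hρ : ∀ i, 0 < ρ i)
    (Φ : Fin n → ℝ) : 0 ≤ Φ ⬝ᵥ Lmat ω ρ *ᵥ Φ := by
  rw [dotProduct_Lmat_mulVec_s9 hG.1 hG.2.1]
  have := Finset.sum_nonneg fun i (_ : i ∈ Finset.univ) =>
    Finset.sum_nonneg fun j (_ : j ∈ Finset.univ) => edgeTerm_nonneg hG.2.2.1 hρ Φ i j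
  linarith

/-- On a connected graph the Dirichlet form is positive on nonzero vectors of zero mean. -/
lemma dotProduct_Lmat_mulVec_pos (hG : IsGraph ω) {ρ : Fin n → ℝ} (hρ : ∀ i, 0 < ρ i)
    {Φ : Fin n → ℝ} (hsum : ∑ i, Φ i = 0) (hΦ : Φ ≠ 0) : 0 < Φ ⬝ᵥ Lmat ω ρ *ᵥ Φ := by
  refine lt_of_le_of_ne (dotProduct_Lmat_mulVec_nonneg hG hρ Φ) fun h => hΦ ?_
  obtain ⟨hs, h0, hω, hconn⟩ := hG
  rw [dotProduct_Lmat_mulVec_s9 hs h0] at h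
  have hz : ∑ i, ∑ j, ω i j * theta ρ i j * (Φ i - Φ j) ^ 2 = 0 := by linarith
  have hedge : ∀ i j, ω i j ≠ 0 → Φ i = Φ j := by
    intro i j hij
    rw [Finset.sum_eq_zero_iff_of_nonneg fun i _ =>
      Finset.sum_nonneg fun j _ => edgeTerm_nonneg hω hρ Φ i j] at hz
    have hi := hz i (Finset.mem_univ i)
    rw [Finset.sum_eq_zero_iff_of_nonneg fun j _ => edgeTerm_nonneg hω hρ Φ i j] at hi
    have := hi j (Finset.mem_univ j)
    simpa [hij, (theta_pos hρ i j).ne', sub_eq_zero] using this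
  have hconst : ∀ i j, Φ i = Φ j := by
    intro i j
    induction hconn i j with
    | refl => rfl
    | tail _ hbc ih => exact ih.trans (hedge _ _ hbc)
  ext i
  have hn : (n : ℝ) * Φ i = 0 := by
    rw [← hsum, Finset.sum_congr rfl fun j _ => hconst j i]
    simp
  have : (n : ℝ) ≠ 0 := Nat.cast_ne_zero.mpr (Fin.pos i).ne'
  simpa [this] using hn

end Laplacian

/-- A continuous family of symmetric matrices annihilating the constants, positive on
nonzero zero-mean vectors at one point, stays positive semidefinite nearby. -/
lemma eventually_quadForm_nonneg {X : Type*} [TopologicalSpace X] {x₀ : X}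
    {A : X → Matrix (Fin n) (Fin n) ℝ} (hA : ContinuousAt A x₀) (hsymm : ∀ x, (A x).IsSymm)
    (hconst : ∀ x (c : ℝ), A x *ᵥ (fun _ => c) = 0)
    (hpos : ∀ Φ : Fin n → ℝ, ∑ i, Φ i = 0 → Φ ≠ 0 → 0 < Φ ⬝ᵥ A x₀ *ᵥ Φ) :
    ∀ᶠ x in nhds x₀, ∀ Φ : Fin n → ℝ, 0 ≤ Φ ⬝ᵥ A x *ᵥ Φ := by
  have hK : IsCompact (Metric.sphere (0 : Fin n → ℝ) 1 ∩ {Φ | ∑ i, Φ i = 0}) :=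
    (isCompact_sphere _ _).inter_right (isClosed_eq (by fun_prop) continuous_const)
  have key : ∀ᶠ x in nhds x₀, ∀ Φ ∈ Metric.sphere (0 : Fin n → ℝ) 1 ∩ {Φ | ∑ i, Φ i = 0},
      0 < Φ ⬝ᵥ A x *ᵥ Φ := by
    refine hK.eventually_forall_of_forall_eventually fun Φ hΦ => ?_
    have hΦ0 : Φ ≠ 0 := by
      rintro rfl
      simp at hΦ
    have hc : ContinuousAt (fun z : X × (Fin n → ℝ) => z.2 ⬝ᵥ A z.1 *ᵥ z.2) (x₀, Φ) := by
      have hq : Continuous fun q : Matrix (Fin n) (Fin n) ℝ × (Fin n → ℝ) =>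
          q.2 ⬝ᵥ q.1 *ᵥ q.2 := by fun_prop
      exact hq.continuousAt.comp (f := fun z : X × (Fin n → ℝ) => (A z.1, z.2))
        ((hA.comp continuousAt_fst).prodMk continuousAt_snd)
    exact hc.eventually (lt_mem_nhds (hpos Φ hΦ.2 hΦ0))
  filter_upwards [key] with x hx Φ
  set m : ℝ := (∑ i, Φ i) / n
  set Ψ : Fin n → ℝ := Φ - fun _ => m with hΨ
  have hform : Φ ⬝ᵥ A x *ᵥ Φ = Ψ ⬝ᵥ A x *ᵥ Ψ := by
    have h1 : (fun _ : Fin n => m) ⬝ᵥ A x *ᵥ Φ = 0 := by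
      rw [dotProduct_mulVec, ← mulVec_transpose, (hsymm x).eq, hconst, zero_dotProduct]
    rw [hΨ, mulVec_sub, hconst, sub_zero, sub_dotProduct, h1, sub_zero]
  rw [hform]
  by_cases h0 : Ψ = 0
  · simp [h0]
  have hsum : ∑ i, Ψ i = 0 := by
    have hn : (n : ℝ) ≠ 0 := by
      rintro hn
      obtain rfl : n = 0 := by exact_mod_cast hn
      exact h0 (Subsingleton.elim _ _)
    simp only [hΨ, Pi.sub_apply, Finset.sum_sub_distrib, m]
    simp
    field_simp
    simp
  have hnorm : 0 < ‖Ψ‖ := norm_pos_iff.mpr h0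
  have := hx (‖Ψ‖⁻¹ • Ψ) ⟨by simp [norm_smul, hnorm.ne'], by
    simp [← Finset.mul_sum, hsum]⟩
  simp only [mulVec_smul, dotProduct_smul, smul_dotProduct, smul_eq_mul] at this
  have hi : 0 < ‖Ψ‖⁻¹ := inv_pos.mpr hnorm
  exact (pos_of_mul_pos_right (pos_of_mul_pos_right this hi.le) hi.le).le

section Derivatives

variable {W : Matrix (Fin n) (Fin n) ℝ} {V : Fin n → ℝ} {β : ℝ}
  {ρ : ℝ → Fin n → ℝ} {v : Fin n → ℝ} {t : ℝ}

lemma hasDerivAt_freeEnergy (hW : W.IsSymm) (hpos : ∀ i, 0 < ρ t i)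
    (h : HasDerivAt ρ v t) :
    HasDerivAt (fun s => freeEnergy W V β (ρ s)) (gradF W V β (ρ t) ⬝ᵥ v) t := by
  have hc := hasDerivAt_pi.mp h
  have h1 : HasDerivAt (fun s => ρ s ⬝ᵥ W *ᵥ ρ s) (v ⬝ᵥ W *ᵥ ρ t + ρ t ⬝ᵥ W *ᵥ v) t := by
    have := HasDerivAt.fun_sum (u := Finset.univ) fun i _ => (hc i).fun_mul
      (HasDerivAt.fun_sum (u := Finset.univ) fun j _ => (hc j).const_mul (W i j))
    rw [Finset.sum_add_distrib] at this
    exact this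
  have h2 : HasDerivAt (fun s => V ⬝ᵥ ρ s) (V ⬝ᵥ v) t :=
    HasDerivAt.fun_sum (u := Finset.univ) fun i _ => (hc i).const_mul (V i)
  have h3 : HasDerivAt (fun s => ∑ i, ρ s i * Real.log (ρ s i))
      (∑ i, (Real.log (ρ t i) + 1) * v i) t :=
    HasDerivAt.fun_sum (u := Finset.univ) fun i _ =>
      HasDerivAt.comp (h₂ := fun x => x * Real.log x) t
        (Real.hasDerivAt_mul_log (hpos i).ne') (hc i)
  refine HasDerivAt.congr_deriv (((h1.const_mul (1 / 2)).add h2).add (h3.const_mul β)) ?_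
  have hsym : ρ t ⬝ᵥ W *ᵥ v = v ⬝ᵥ W *ᵥ ρ t := by
    rw [dotProduct_mulVec, ← mulVec_transpose, hW.eq, dotProduct_comm]
  rw [hsym]
  have hdbl : 1 / 2 * (v ⬝ᵥ W *ᵥ ρ t + v ⬝ᵥ W *ᵥ ρ t) = v ⬝ᵥ W *ᵥ ρ t := by ring
  rw [hdbl]
  rw [dotProduct, dotProduct, dotProduct]
  simp only [gradF, Finset.mul_sum, ← Finset.sum_add_distrib]
  exact Finset.sum_congr rfl fun i _ => by ring

lemma hasDerivAt_gradF (hpos : ∀ i, 0 < ρ t i) (h : HasDerivAt ρ v t) :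
    HasDerivAt (fun s => gradF W V β (ρ s)) (hessF W β (ρ t) *ᵥ v) t := by
  have hc := hasDerivAt_pi.mp h
  refine hasDerivAt_pi.mpr fun i => ?_
  have h1 : HasDerivAt (fun s => (W *ᵥ ρ s) i) ((W *ᵥ v) i) t :=
    HasDerivAt.fun_sum (u := Finset.univ) fun j _ => (hc j).const_mul (W i j)
  have h2 := ((hc i).log (hpos i).ne').const_mul β
  refine HasDerivAt.congr_deriv (((h1.const_add (V i)).add h2).add_const β) ?_
  simp only [hessF, add_mulVec, smul_mulVec, Pi.add_apply, Pi.smul_apply, mulVec_diagonal,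
    smul_eq_mul]
  ring

lemma hasDerivAt_Lmat {ω : Fin n → Fin n → ℝ} (h : HasDerivAt ρ v t) (i j : Fin n) :
    HasDerivAt (fun s => Lmat ω (ρ s) i j) (Lmat ω v i j) t := by
  have hc := hasDerivAt_pi.mp h
  have hθ : ∀ k, HasDerivAt (fun s => ω i k * theta (ρ s) i k) (ω i k * theta v i k) t :=
    fun k => (((hc i).add (hc k)).div_const 2).const_mul _
  by_cases hij : i = j
  · simpa [Lmat, hij] using HasDerivAt.fun_sum (u := Finset.univ) fun k _ => hij ▸ hθ k
  · simpa [Lmat, hij] using (hθ j).fun_neg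

lemma hasDerivAt_dotProduct_mulVec {A : ℝ → Matrix (Fin n) (Fin n) ℝ}
    {A' : Matrix (Fin n) (Fin n) ℝ} {Φ : ℝ → Fin n → ℝ} {Φ' : Fin n → ℝ}
    (hA : ∀ i j, HasDerivAt (fun s => A s i j) (A' i j) t) (hΦ : HasDerivAt Φ Φ' t) :
    HasDerivAt (fun s => Φ s ⬝ᵥ A s *ᵥ Φ s)
      (Φ' ⬝ᵥ A t *ᵥ Φ t + Φ t ⬝ᵥ A' *ᵥ Φ t + Φ t ⬝ᵥ A t *ᵥ Φ') t := by
  have hc := hasDerivAt_pi.mp hΦ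
  have := HasDerivAt.fun_sum (u := Finset.univ) fun i _ => (hc i).fun_mul
    (HasDerivAt.fun_sum (u := Finset.univ) fun j _ => (hA i j).fun_mul (hc j))
  refine this.congr_deriv ?_
  simp only [Finset.sum_add_distrib, mul_add]
  simp only [dotProduct, mulVec]
  ring

/-- Second-order dissipation identity along the Fokker–Planck flow. -/
lemma hasDerivAt_dissipation {ω : Fin n → Fin n → ℝ} (hs : ∀ i j, ω i j = ω j i)
    (hpos : ∀ i, 0 < ρ t i)
    (hv : v = -(Lmat ω (ρ t) *ᵥ gradF W V β (ρ t))) (h : HasDerivAt ρ v t) :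
    HasDerivAt (fun s => gradF W V β (ρ s) ⬝ᵥ Lmat ω (ρ s) *ᵥ gradF W V β (ρ s))
      (-(2 * (gradF W V β (ρ t) ⬝ᵥ
          (Lmat ω (ρ t) * hessF W β (ρ t) * Lmat ω (ρ t)) *ᵥ gradF W V β (ρ t)) -
        gradF W V β (ρ t) ⬝ᵥ Lmat ω v *ᵥ gradF W V β (ρ t))) t := by
  refine (hasDerivAt_dotProduct_mulVec (hasDerivAt_Lmat h)
    (hasDerivAt_gradF hpos h)).congr_deriv ?_
  set F := gradF W V β (ρ t)
  set L := Lmat ω (ρ t) with hL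
  set H := hessF W β (ρ t)
  have h1 : F ⬝ᵥ L *ᵥ H *ᵥ v = -(F ⬝ᵥ (L * H * L) *ᵥ F) := by
    rw [hv, mulVec_neg, mulVec_neg, dotProduct_neg, mulVec_mulVec, mulVec_mulVec, mul_assoc]
  have h2 : (H *ᵥ v) ⬝ᵥ L *ᵥ F = F ⬝ᵥ L *ᵥ H *ᵥ v := by
    rw [dotProduct_mulVec, ← mulVec_transpose, (Lmat_isSymm hs _).eq, dotProduct_comm]
  rw [h2, h1]
  ring

end Derivatives

lemma hessF_isSymm {W : Matrix (Fin n) (Fin n) ℝ} (hW : W.IsSymm) (β : ℝ) (ρ : Fin n → ℝ) :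
    (hessF W β ρ).IsSymm :=
  hW.add ((Matrix.isSymm_diagonal _).smul β)

lemma continuous_Lmat (ω : Fin n → Fin n → ℝ) : Continuous (Lmat ω) := by
  refine continuous_matrix fun i j => ?_
  unfold Lmat theta
  split_ifs <;> fun_prop

lemma continuousAt_gradF (W : Matrix (Fin n) (Fin n) ℝ) (V : Fin n → ℝ) (β : ℝ)
    {σ : Fin n → ℝ} (hσ : ∀ i, 0 < σ i) : ContinuousAt (gradF W V β) σ := by
  refine continuousAt_pi.mpr fun i => ?_
  have h1 : ContinuousAt (fun ρ : Fin n → ℝ => (W *ᵥ ρ) i) σ :=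
    Continuous.continuousAt (by fun_prop)
  have h2 : ContinuousAt (fun ρ : Fin n → ℝ => Real.log (ρ i)) σ :=
    (continuous_apply i).continuousAt.log (hσ i).ne'
  exact ((continuousAt_const.add h1).add (continuousAt_const.mul h2)).add continuousAt_const

lemma continuous_freeEnergy (W : Matrix (Fin n) (Fin n) ℝ) (V : Fin n → ℝ) (β : ℝ) :
    Continuous (freeEnergy W V β) := by
  have h : ∀ i : Fin n, Continuous fun ρ : Fin n → ℝ => ρ i * Real.log (ρ i) := fun i =>
    Real.continuous_mul_log.comp (continuous_apply i)
  unfold freeEnergy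
  fun_prop

lemma continuousAt_hessF (W : Matrix (Fin n) (Fin n) ℝ) (β : ℝ)
    {σ : Fin n → ℝ} (hσ : ∀ i, 0 < σ i) : ContinuousAt (hessF W β) σ := by
  have h : ContinuousAt (fun ρ : Fin n → ℝ => fun i => (ρ i)⁻¹) σ :=
    continuousAt_pi.mpr fun i => (continuous_apply i).continuousAt.inv₀ (hσ i).ne'
  have hd : Continuous fun d : Fin n → ℝ => W + β • Matrix.diagonal d := by fun_prop
  exact hd.continuousAt.comp h

/-- A lower bound of the normalized Rayleigh quotient gives a bound of quadratic forms. -/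
lemma sInf_mul_le_quadForm {A B : Matrix (Fin n) (Fin n) ℝ} {lam : ℝ}
    (hlam : lam = sInf {y : ℝ | ∃ Φ : Fin n → ℝ, Φ ⬝ᵥ A *ᵥ Φ = 1 ∧ y = Φ ⬝ᵥ B *ᵥ Φ})
    (hpos : 0 < lam) {Φ : Fin n → ℝ} (hΦ : 0 < Φ ⬝ᵥ A *ᵥ Φ) :
    lam * (Φ ⬝ᵥ A *ᵥ Φ) ≤ Φ ⬝ᵥ B *ᵥ Φ := by
  have hbdd : BddBelow {y : ℝ | ∃ Φ : Fin n → ℝ, Φ ⬝ᵥ A *ᵥ Φ = 1 ∧ y = Φ ⬝ᵥ B *ᵥ Φ} := by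
    by_contra h
    rw [Real.sInf_of_not_bddBelow h] at hlam
    exact hpos.ne' hlam
  set a := Φ ⬝ᵥ A *ᵥ Φ with ha
  have hsq : (√a)⁻¹ * (√a)⁻¹ = a⁻¹ := by
    rw [← mul_inv, Real.mul_self_sqrt hΦ.le]
  have hscale : ∀ M : Matrix (Fin n) (Fin n) ℝ,
      ((√a)⁻¹ • Φ) ⬝ᵥ M *ᵥ ((√a)⁻¹ • Φ) = a⁻¹ * (Φ ⬝ᵥ M *ᵥ Φ) := by
    intro M
    rw [mulVec_smul, dotProduct_smul, smul_dotProduct, smul_eq_mul, smul_eq_mul, ← mul_assoc,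
      hsq]
  have hle : lam ≤ a⁻¹ * (Φ ⬝ᵥ B *ᵥ Φ) := by
    rw [hlam]
    exact csInf_le hbdd ⟨(√a)⁻¹ • Φ, by rw [hscale, ← ha, inv_mul_cancel₀ hΦ.ne'], (hscale B).symm⟩
  rw [inv_mul_eq_div, le_div_iff₀ hΦ] at hle
  exact hle

/-- Near the equilibrium, the second-order dissipation dominates the first-order one. -/
lemma eventually_dissipation_le {ω : Fin n → Fin n → ℝ} (hG : IsGraph ω)
    {W : Matrix (Fin n) (Fin n) ℝ} (hW : W.IsSymm) (V : Fin n → ℝ) (β : ℝ)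
    {σ : Fin n → ℝ} (hσ : ∀ i, 0 < σ i) (heq : Lmat ω σ *ᵥ gradF W V β σ = 0)
    {lam c : ℝ} (hc : c < lam)
    (hlam : ∀ Φ : Fin n → ℝ, 0 < Φ ⬝ᵥ Lmat ω σ *ᵥ Φ → lam * (Φ ⬝ᵥ Lmat ω σ *ᵥ Φ) ≤
      Φ ⬝ᵥ (Lmat ω σ * hessF W β σ * Lmat ω σ) *ᵥ Φ) :
    ∀ᶠ p in nhds σ, ∀ Φ : Fin n → ℝ, 2 * c * (Φ ⬝ᵥ Lmat ω p *ᵥ Φ) ≤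
      2 * (Φ ⬝ᵥ (Lmat ω p * hessF W β p * Lmat ω p) *ᵥ Φ) -
        Φ ⬝ᵥ Lmat ω (-(Lmat ω p *ᵥ gradF W V β p)) *ᵥ Φ := by
  have hL := (continuous_Lmat ω).continuousAt (x := σ)
  have hform : ∀ (p Φ : Fin n → ℝ), Φ ⬝ᵥ ((2 : ℝ) • (Lmat ω p * hessF W β p * Lmat ω p) -
      Lmat ω (-(Lmat ω p *ᵥ gradF W V β p)) - (2 * c) • Lmat ω p) *ᵥ Φ =
      2 * (Φ ⬝ᵥ (Lmat ω p * hessF W β p * Lmat ω p) *ᵥ Φ) -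
        Φ ⬝ᵥ Lmat ω (-(Lmat ω p *ᵥ gradF W V β p)) *ᵥ Φ - 2 * c * (Φ ⬝ᵥ Lmat ω p *ᵥ Φ) := by
    intro p Φ
    simp only [sub_mulVec, smul_mulVec, dotProduct_sub, dotProduct_smul, smul_eq_mul]
  have key := eventually_quadForm_nonneg (x₀ := σ)
    (A := fun p => (2 : ℝ) • (Lmat ω p * hessF W β p * Lmat ω p) -
      Lmat ω (-(Lmat ω p *ᵥ gradF W V β p)) - (2 * c) • Lmat ω p) ?_ ?_ ?_ ?_
  · filter_upwards [key] with p hp Φ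
    have := hp Φ
    rw [hform] at this
    linarith
  · have hη : ContinuousAt (fun p => -(Lmat ω p *ᵥ gradF W V β p)) σ := by
      have hm : Continuous fun q : Matrix (Fin n) (Fin n) ℝ × (Fin n → ℝ) =>
          -(q.1 *ᵥ q.2) := by fun_prop
      exact hm.continuousAt.comp (f := fun p => (Lmat ω p, gradF W V β p))
        (hL.prodMk (continuousAt_gradF W V β hσ))
    have hLη : ContinuousAt (fun p => Lmat ω (-(Lmat ω p *ᵥ gradF W V β p))) σ :=
      (continuous_Lmat ω).continuousAt.comp hη
    exact ((((hL.mul (continuousAt_hessF W β hσ)).mul hL).const_smul (2 : ℝ)).sub hLη).sub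
      (hL.const_smul (2 * c))
  · intro p
    have hp := Lmat_isSymm hG.1 p
    refine Matrix.IsSymm.sub (Matrix.IsSymm.sub (Matrix.IsSymm.smul ?_ _)
      (Lmat_isSymm hG.1 _)) (hp.smul _)
    rw [Matrix.IsSymm, transpose_mul, transpose_mul, hp.eq, (hessF_isSymm hW β p).eq, mul_assoc]
  · intro p a
    simp only [sub_mulVec, smul_mulVec, ← mulVec_mulVec, Lmat_mulVec_const hG.2.1]
    simp
  · intro Φ hsum hΦ
    have hΦpos := dotProduct_Lmat_mulVec_pos hG hσ hsum hΦ
    have h1 := hlam Φ hΦpos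
    rw [hform, heq, neg_zero, Lmat_zero, zero_mulVec, dotProduct_zero]
    nlinarith [mul_pos (sub_pos.mpr hc) hΦpos]

/-- asymptotic convergence rate near an isolated equilibrium. -/
theorem asymptotic_rate
    (n : ℕ) (hn : 2 ≤ n) (ω : Fin n → Fin n → ℝ) (hG : IsGraph ω)
    (W : Matrix (Fin n) (Fin n) ℝ) (hW : W.IsSymm) (V : Fin n → ℝ) (β : ℝ) (hβ : 0 < β)
    (ρ0 : Fin n → ℝ) (hρ0 : PoG ρ0)
    (ρ : ℝ → Fin n → ℝ) (hsol : IsSolution ω W V β ρ) (hinit : ρ 0 = ρ0)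
    (ρinf : Fin n → ℝ) (hρinf : PoG ρinf)
    (htend : Tendsto ρ atTop (nhds ρinf))
    (heq : (Lmat ω ρinf).mulVec (gradF W V β ρinf) = 0)
    (hiso : ∃ δ > (0:ℝ), ∀ σ : Fin n → ℝ, PoG σ → ‖σ - ρinf‖ < δ →
      (Lmat ω σ).mulVec (gradF W V β σ) = 0 → σ = ρinf)
    (lam : ℝ)
    (hlam : lam = sInf {y : ℝ | ∃ Φ : Fin n → ℝ,
      Φ ⬝ᵥ (Lmat ω ρinf).mulVec Φ = 1 ∧
      y = Φ ⬝ᵥ (Lmat ω ρinf * hessF W β ρinf * Lmat ω ρinf).mulVec Φ})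
    (hlampos : 0 < lam) :
    ∀ ε : ℝ, 0 < ε → ε < lam → ∃ T > (0:ℝ), ∀ t > T,
      freeEnergy W V β (ρ t) - freeEnergy W V β ρinf ≤
        Real.exp (-2 * (lam - ε) * (t - T)) *
          (freeEnergy W V β ρ0 - freeEnergy W V β ρinf) := by
  intro ε hε hεlam
  obtain ⟨hPo, hder⟩ := hsol
  set c := lam - ε with hc
  set F := gradF W V β with hF
  set G : ℝ → ℝ := fun s => freeEnergy W V β (ρ s) with hGdef
  set Ginf := freeEnergy W V β ρinf with hGinf
  set I : ℝ → ℝ := fun s => F (ρ s) ⬝ᵥ Lmat ω (ρ s) *ᵥ F (ρ s) with hI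
  have hρ : ∀ t, 0 < t → HasDerivAt ρ (-(Lmat ω (ρ t) *ᵥ F (ρ t))) t := fun t ht =>
    (hder t ht.le).hasDerivAt (Ici_mem_nhds ht)
  have hG' : ∀ t, 0 < t → HasDerivAt G (-I t) t := fun t ht =>
    (hasDerivAt_freeEnergy hW (hPo t ht.le).2 (hρ t ht)).congr_deriv (dotProduct_neg _ _)
  have hGcont : ContinuousOn G (Set.Ici 0) := fun t ht =>
    (continuous_freeEnergy W V β).continuousAt.comp_continuousWithinAt
      (hder t ht).continuousWithinAt
  have hGanti : AntitoneOn G (Set.Ici 0) := by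
    refine antitoneOn_of_hasDerivWithinAt_nonpos (convex_Ici 0) hGcont (f' := fun t => -I t) ?_ ?_
    · intro t ht
      rw [interior_Ici] at ht
      exact (hG' t ht).hasDerivWithinAt
    · intro t ht
      rw [interior_Ici] at ht
      exact neg_nonpos.mpr (dotProduct_Lmat_mulVec_nonneg hG (hPo t (Set.Ioi_subset_Ici_self ht)).2 _)
  have hev := htend.eventually (eventually_dissipation_le hG hW V β hρinf.2 heq
    (show c < lam by linarith) fun Φ hΦ => sInf_mul_le_quadForm hlam hlampos hΦ)
  obtain ⟨T₀, hT₀⟩ := eventually_atTop.mp hev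
  set T := max T₀ 1 with hT
  have hTpos : 0 < T := lt_of_lt_of_le one_pos (le_max_right _ _)
  have hGlim : Tendsto G atTop (nhds Ginf) :=
    ((continuous_freeEnergy W V β).tendsto ρinf).comp htend
  have hIlim : Tendsto I atTop (nhds 0) := by
    have hq : Continuous fun q : Matrix (Fin n) (Fin n) ℝ × (Fin n → ℝ) =>
        q.2 ⬝ᵥ q.1 *ᵥ q.2 := by fun_prop
    have h1 := (hq.tendsto (Lmat ω ρinf, F ρinf)).comp
      ((((continuous_Lmat ω).tendsto ρinf).comp htend).prodMk_nhds
        ((continuousAt_gradF W V β hρinf.2).tendsto.comp htend))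
    have h2 : F ρinf ⬝ᵥ Lmat ω ρinf *ᵥ F ρinf = 0 := by
      rw [hF, heq, dotProduct_zero]
    rw [← h2]
    exact h1
  have hdiff : ∀ t, T ≤ t → ∃ d ≤ 0, HasDerivAt (fun s => I s - 2 * c * G s) d t := by
    intro t ht
    have ht0 : 0 < t := hTpos.trans_le ht
    have hb := hT₀ t ((le_max_left _ _).trans ht) (F (ρ t))
    refine ⟨_, ?_, (hasDerivAt_dissipation hG.1 (hPo t ht0.le).2 rfl (hρ t ht0)).sub
      ((hG' t ht0).const_mul (2 * c))⟩
    linarith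
  have hIG : ∀ t, T ≤ t → 2 * c * (G t - Ginf) ≤ I t := by
    have hanti : AntitoneOn (fun s => I s - 2 * c * G s) (Set.Ici T) := by
      refine antitoneOn_of_deriv_nonpos (convex_Ici T) ?_ ?_ ?_
      · intro t ht
        obtain ⟨d, -, hd⟩ := hdiff t ht
        exact hd.continuousAt.continuousWithinAt
      · intro t ht
        obtain ⟨d, -, hd⟩ := hdiff t (interior_subset ht)
        exact hd.differentiableAt.differentiableWithinAt
      · intro t ht
        obtain ⟨d, hd0, hd⟩ := hdiff t (interior_subset ht)
        rwa [hd.deriv]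
    intro t ht
    have hle : 0 - 2 * c * Ginf ≤ I t - 2 * c * G t := by
      refine le_of_tendsto (hIlim.sub (hGlim.const_mul (2 * c))) ?_
      filter_upwards [eventually_ge_atTop t] with s hs
      exact hanti ht (ht.trans hs) hs
    linarith
  refine ⟨T, hTpos, fun t ht => ?_⟩
  have hexp : ∀ s, T ≤ s → HasDerivAt (fun s => Real.exp (2 * c * (s - T)) * (G s - Ginf))
      (Real.exp (2 * c * (s - T)) * (2 * c * (G s - Ginf) - I s)) s := by
    intro s hs
    have h1 : HasDerivAt (fun s : ℝ => Real.exp (2 * c * (s - T)))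
        (Real.exp (2 * c * (s - T)) * (2 * c * 1)) s :=
      (((hasDerivAt_id s).sub_const T).const_mul (2 * c)).exp
    refine (h1.mul ((hG' s (hTpos.trans_le hs)).sub_const Ginf)).congr_deriv ?_
    ring
  have hdecay : AntitoneOn (fun s => Real.exp (2 * c * (s - T)) * (G s - Ginf)) (Set.Ici T) := by
    refine antitoneOn_of_hasDerivWithinAt_nonpos (convex_Ici T)
      (fun s hs => (hexp s hs).continuousAt.continuousWithinAt)
      (fun s hs => (hexp s (interior_subset hs)).hasDerivWithinAt) fun s hs => ?_
    exact mul_nonpos_of_nonneg_of_nonpos (Real.exp_nonneg _)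
      (sub_nonpos.mpr (hIG s (interior_subset hs)))
  have h1 : Real.exp (2 * c * (t - T)) * (G t - Ginf) ≤ G T - Ginf := by
    simpa using hdecay (Set.mem_Ici.mpr le_rfl) (Set.mem_Ici.mpr ht.le) ht.le
  have h2 : G T ≤ freeEnergy W V β ρ0 := by
    rw [← hinit]
    exact hGanti (Set.mem_Ici.mpr le_rfl) (Set.mem_Ici.mpr hTpos.le) hTpos.le
  have h3 : Real.exp (-2 * c * (t - T)) * Real.exp (2 * c * (t - T)) = 1 := by
    rw [← Real.exp_add, ← Real.exp_zero]
    congr 1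
    ring
  calc G t - Ginf
      = Real.exp (-2 * c * (t - T)) * (Real.exp (2 * c * (t - T)) * (G t - Ginf)) := by
        rw [← mul_assoc, h3, one_mul]
    _ ≤ _ := mul_le_mul_of_nonneg_left (by linarith) (Real.exp_nonneg _)

end FPEGraph
end
end

section
/- Let ρ∞ ∈ P_o(G) be a Gibbs measure, let ρ ∈ P_o(G) satisfy ρ_i ≥ m for all i with some m ∈ (0, 1/n], and let h₁ > 0 satisfy ‖Hess𝓕(σ)‖₁ ≤ h₁ (maximum absolute column sum norm) for every σ on the line segment from ρ to ρ∞. Then max_{(i,j)∈E} |F_i(ρ) − F_j(ρ)| ≤ 2·h₁·‖ρ − ρ∞‖₂ and ‖L(ρ)F(ρ)‖_∞ ≤ 2·Deg(G)·max_{(i,j)∈E} ω_{ij}·(1−m)·h₁·‖ρ − ρ∞‖₂. -/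
open Finset Filter Matrix
open scoped Classical

noncomputable section

namespace FPEGraph

variable {n : ℕ}

/-- Row `i` of `A *ᵥ d` is controlled by the maximum column sum norm when `A` is symmetric. -/
lemma abs_mulVec_le_matNorm1 {A : Matrix (Fin n) (Fin n) ℝ} (hA : A.IsSymm) {d : Fin n → ℝ}
    {D : ℝ} (hd : ∀ k, |d k| ≤ D) (i : Fin n) : |A.mulVec d i| ≤ matNorm1 A * D := by
  have hrow : ∑ k, |A i k| ≤ matNorm1 A := by
    calc ∑ k, |A i k| = ∑ k, |A k i| := by simp only [hA.apply]
      _ ≤ matNorm1 A := le_ciSup (f := fun j => ∑ k, |A k j|) (Set.finite_range _).bddAbove i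
  calc |A.mulVec d i| ≤ ∑ k, |A i k * d k| := by
        simpa only [mulVec, dotProduct] using abs_sum_le_sum_abs (fun k => A i k * d k) univ
    _ ≤ ∑ k, |A i k| * D := by
        gcongr with k
        rw [abs_mul]
        exact mul_le_mul_of_nonneg_left (hd k) (abs_nonneg _)
    _ = (∑ k, |A i k|) * D := by rw [sum_mul]
    _ ≤ matNorm1 A * D :=
        mul_le_mul_of_nonneg_right hrow ((abs_nonneg _).trans (hd i))

lemma hasDerivAt_gradF_segment (W : Matrix (Fin n) (Fin n) ℝ) (V : Fin n → ℝ) (β : ℝ)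
    (ρ σ : Fin n → ℝ) (i : Fin n) {s : ℝ} (hs : (1 - s) * ρ i + s * σ i ≠ 0) :
    HasDerivAt (fun t : ℝ => gradF W V β (fun k => (1 - t) * ρ k + t * σ k) i)
      ((hessF W β (fun k => (1 - s) * ρ k + s * σ k)).mulVec (fun k => σ k - ρ k) i) s := by
  have hlin : ∀ k, HasDerivAt (fun t : ℝ => (1 - t) * ρ k + t * σ k) (σ k - ρ k) s := by
    intro k
    have := (((hasDerivAt_id s).const_sub 1).mul_const (ρ k)).add
      ((hasDerivAt_id s).mul_const (σ k))
    exact this.congr_deriv (by ring)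
  have hlinW : HasDerivAt (fun t : ℝ => W.mulVec (fun k => (1 - t) * ρ k + t * σ k) i)
      (W.mulVec (fun k => σ k - ρ k) i) s := by
    simp only [mulVec, dotProduct]
    exact HasDerivAt.fun_sum fun k _ => (hlin k).const_mul (W i k)
  have hlog := ((hlin i).log hs).const_mul β
  refine (((hlinW.const_add (V i)).add hlog).add_const β).congr_deriv ?_
  simp only [hessF, add_mulVec, smul_mulVec, Pi.add_apply, Pi.smul_apply, mulVec_diagonal,
    smul_eq_mul]
  ring

lemma abs_gradF_sub_gradF_le {W : Matrix (Fin n) (Fin n) ℝ} (hW : W.IsSymm) (V : Fin n → ℝ)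
    (β : ℝ) {ρ σ : Fin n → ℝ} (hρ : ∀ i, 0 < ρ i) (hσ : ∀ i, 0 < σ i) {h D : ℝ}
    (hseg : ∀ s ∈ Set.Icc (0 : ℝ) 1,
      matNorm1 (hessF W β (fun i => (1 - s) * ρ i + s * σ i)) ≤ h)
    (hD : ∀ k, |ρ k - σ k| ≤ D) (i : Fin n) :
    |gradF W V β ρ i - gradF W V β σ i| ≤ h * D := by
  have hpos : ∀ s ∈ Set.Icc (0 : ℝ) 1, 0 < (1 - s) * ρ i + s * σ i := by
    rintro s ⟨h0, h1⟩
    rcases h0.eq_or_lt with rfl | h0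
    · simpa using hρ i
    · exact add_pos_of_nonneg_of_pos (mul_nonneg (sub_nonneg.2 h1) (hρ i).le)
        (mul_pos h0 (hσ i))
  have hmv := norm_image_sub_le_of_norm_deriv_le_segment_01' (C := h * D)
    (fun s hs => (hasDerivAt_gradF_segment W V β ρ σ i (hpos s hs).ne').hasDerivWithinAt)
    (fun s hs => by
      have hs' := Set.Ico_subset_Icc_self hs
      have hD' : ∀ k, |σ k - ρ k| ≤ D := fun k => abs_sub_comm (ρ k) (σ k) ▸ hD k
      exact (abs_mulVec_le_matNorm1 (hessF_isSymm hW β _) hD' i).trans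
        (mul_le_mul_of_nonneg_right (hseg s hs') ((abs_nonneg _).trans (hD i))))
  rw [abs_sub_comm]
  simpa using hmv

/-- The free energy gradient is constant at a Gibbs measure. -/
lemma IsGibbs.gradF_eq {W : Matrix (Fin n) (Fin n) ℝ} {V : Fin n → ℝ} {β : ℝ} (hβ : β ≠ 0)
    {ρ : Fin n → ℝ} (h : IsGibbs W V β ρ) (i j : Fin n) :
    gradF W V β ρ i = gradF W V β ρ j := by
  suffices ∀ i, gradF W V β ρ i =
      β - β * Real.log (∑ j, Real.exp (-(W.mulVec ρ j + V j) / β)) by rw [this, this]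
  intro i
  have hK : 0 < ∑ j, Real.exp (-(W.mulVec ρ j + V j) / β) :=
    sum_pos (fun _ _ => Real.exp_pos _) ⟨i, mem_univ i⟩
  have hlog : Real.log (ρ i) = -(W.mulVec ρ i + V i) / β -
      Real.log (∑ j, Real.exp (-(W.mulVec ρ j + V j) / β)) := by
    conv_lhs => rw [h.2 i]
    rw [Real.log_div (Real.exp_pos _).ne' hK.ne', Real.log_exp]
  rw [gradF, hlog]
  field_simp
  ring

lemma Lmat_mulVec_apply {ω : Fin n → Fin n → ℝ} (hω : ∀ i, ω i i = 0) (ρ Φ : Fin n → ℝ)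
    (i : Fin n) : (Lmat ω ρ).mulVec Φ i = ∑ j, ω i j * theta ρ i j * (Φ i - Φ j) := by
  have hentry : ∀ j, Lmat ω ρ i j * Φ j =
      (if i = j then (∑ k, ω i k * theta ρ i k) * Φ j else 0) -
        ω i j * theta ρ i j * Φ j := by
    intro j
    by_cases hij : i = j
    · subst hij
      simp [Lmat, hω]
    · simp [Lmat, hij]
  calc (Lmat ω ρ).mulVec Φ i = ∑ j, Lmat ω ρ i j * Φ j := rfl
    _ = ∑ j, ω i j * theta ρ i j * (Φ i - Φ j) := by
      simp only [hentry, mul_sub, sum_sub_distrib, sum_ite_eq, mem_univ, if_true, sum_mul]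

lemma le_maxWeight (ω : Fin n → Fin n → ℝ) (i j : Fin n) : ω i j ≤ maxWeight ω :=
  (le_ciSup (f := fun j => ω i j) (Set.finite_range _).bddAbove j).trans
    (le_ciSup (f := fun i => ⨆ j, ω i j) (Set.finite_range _).bddAbove i)

lemma theta_le_half {ρ : Fin n → ℝ} (hρ : PG ρ) {i j : Fin n} (hij : i ≠ j) :
    theta ρ i j ≤ 1 / 2 := by
  have h := sum_le_univ_sum_of_nonneg hρ.2 (s := {i, j})
  rw [sum_pair hij, hρ.1] at h
  unfold theta
  linarith

lemma abs_Lmat_mulVec_le {ω : Fin n → Fin n → ℝ} (hG : IsGraph ω) {ρ : Fin n → ℝ} (hρ : PG ρ)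
    {Φ : Fin n → ℝ} {B : ℝ} (hB : 0 ≤ B) (hΦ : ∀ i j, ω i j ≠ 0 → |Φ i - Φ j| ≤ B)
    (i : Fin n) :
    |(Lmat ω ρ).mulVec Φ i| ≤ maxDeg ω * (maxWeight ω * (1 / 2) * B) := by
  obtain ⟨-, hdiag, hnn, -⟩ := hG
  have hMW : 0 ≤ maxWeight ω := (hnn i i).trans (le_maxWeight ω i i)
  rw [Lmat_mulVec_apply hdiag,
    ← sum_filter_of_ne (p := fun j => ω i j ≠ 0) fun j _ h h0 => h (by rw [h0]; ring)]
  have hterm : ∀ j ∈ univ.filter (fun j => ω i j ≠ 0),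
      |ω i j * theta ρ i j * (Φ i - Φ j)| ≤ maxWeight ω * (1 / 2) * B := by
    intro j hj
    have hj := (mem_filter.1 hj).2
    have hθ : 0 ≤ theta ρ i j := div_nonneg (add_nonneg (hρ.2 i) (hρ.2 j)) zero_le_two
    rw [abs_mul, abs_mul, abs_of_nonneg (hnn i j), abs_of_nonneg hθ]
    have hθ' : theta ρ i j ≤ 1 / 2 := theta_le_half hρ (by rintro rfl; exact hj (hdiag i))
    gcongr
    exacts [le_maxWeight ω i j, hΦ i j hj]
  calc _ ≤ ∑ j ∈ univ.filter (fun j => ω i j ≠ 0), |ω i j * theta ρ i j * (Φ i - Φ j)| :=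
        abs_sum_le_sum_abs _ _
    _ ≤ (univ.filter fun j => ω i j ≠ 0).card • (maxWeight ω * (1 / 2) * B) :=
        sum_le_card_nsmul _ _ _ hterm
    _ ≤ maxDeg ω * (maxWeight ω * (1 / 2) * B) := by
        rw [nsmul_eq_mul]
        gcongr
        exact le_sup (f := fun i => (univ.filter fun j => ω i j ≠ 0).card) (mem_univ i)

/-- gradient and velocity bounds near the Gibbs measure:
`max_{(i,j)∈E} |F_i(ρ) - F_j(ρ)| ≤ 2 h₁ ‖ρ - ρ∞‖₂` and
`‖L(ρ)F(ρ)‖_∞ ≤ 2 Deg(G) max ω (1-m) h₁ ‖ρ - ρ∞‖₂`. -/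
theorem gradient_and_velocity_bounds
    (n : ℕ) (hn : 2 ≤ n) (ω : Fin n → Fin n → ℝ) (hG : IsGraph ω)
    (W : Matrix (Fin n) (Fin n) ℝ) (hW : W.IsSymm) (V : Fin n → ℝ) (β : ℝ) (hβ : 0 < β)
    (ρinf : Fin n → ℝ) (hGibbs : IsGibbs W V β ρinf)
    (ρ : Fin n → ℝ) (hρ : PoG ρ)
    (m : ℝ) (hm : 0 < m) (hmn : m ≤ 1 / n) (hmρ : ∀ i, m ≤ ρ i)
    (h1 : ℝ) (hh1 : 0 < h1)
    (hseg : ∀ s ∈ Set.Icc (0:ℝ) 1,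
      matNorm1 (hessF W β (fun i => (1 - s) * ρ i + s * ρinf i)) ≤ h1) :
    (∀ i j, ω i j ≠ 0 →
      |gradF W V β ρ i - gradF W V β ρ j| ≤
        2 * h1 * Real.sqrt (∑ k, (ρ k - ρinf k)^2)) ∧
    ∀ i, |(Lmat ω ρ).mulVec (gradF W V β ρ) i| ≤
      2 * (maxDeg ω : ℝ) * maxWeight ω * (1 - m) * h1 *
        Real.sqrt (∑ k, (ρ k - ρinf k)^2) := by
  set D := Real.sqrt (∑ k, (ρ k - ρinf k)^2)
  have hD : ∀ k, |ρ k - ρinf k| ≤ D := fun k => by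
    rw [← Real.sqrt_sq_eq_abs]
    exact Real.sqrt_le_sqrt
      (single_le_sum (f := fun k => (ρ k - ρinf k)^2) (fun _ _ => sq_nonneg _) (mem_univ k))
  have hgrad : ∀ i j, ω i j ≠ 0 → |gradF W V β ρ i - gradF W V β ρ j| ≤ 2 * h1 * D := by
    intro i j _
    have hi := abs_le.1 (abs_gradF_sub_gradF_le hW V β hρ.2 hGibbs.1.2 hseg hD i)
    have hj := abs_le.1 (abs_gradF_sub_gradF_le hW V β hρ.2 hGibbs.1.2 hseg hD j)
    have hij := hGibbs.gradF_eq hβ.ne' i j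
    exact abs_le.2 ⟨by linarith [hi.1, hj.2], by linarith [hi.2, hj.1]⟩
  refine ⟨hgrad, fun i => ?_⟩
  have hm_half : m ≤ 1 / 2 :=
    hmn.trans (one_div_le_one_div_of_le two_pos (by exact_mod_cast hn))
  have hMW : 0 ≤ maxWeight ω := (hG.2.2.1 i i).trans (le_maxWeight ω i i)
  calc _ ≤ maxDeg ω * (maxWeight ω * (1 / 2) * (2 * h1 * D)) :=
        abs_Lmat_mulVec_le hG ⟨hρ.1, fun k => (hρ.2 k).le⟩ (by positivity) hgrad i
    _ ≤ maxDeg ω * (maxWeight ω * (1 - m) * (2 * h1 * D)) := by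
        gcongr
        linarith
    _ = _ := by ring

end FPEGraph
end
end
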